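/- Let n ≥ 1. (i) For nonempty subsets S′ ⊊ S of Fin n and integers l, l′ ≥ 1, the idempotent matrix (⊞^l ∂(Q_S)) ⊞ (⊞^{l′} ∂(Q_{S′})) over A_n is equivalent to ⊞^l ∂(Q_S). (ii) If A and A′ are finite antichains under inclusion consisting of nonempty subsets of Fin n, with weight functions l : A → ℕ and l′ : A′ → ℕ taking values ≥ 1, then ⊞_{S∈A} ⊞^{l(S)} ∂(Q_S) and ⊞_{S∈A′} ⊞^{l′(S)} ∂(Q_S) are equivalent over A_n if and only if A = A′ and l = l′. -/

import Mathlib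

noncomputable section

/-- `H n` is the Hilbert space `ℓ²(ℕ^n)`. -/
abbrev Hn (n : ℕ) : Type := lp (fun _ : (Fin n → ℕ) => ℂ) 2

/-- the standard basis vector `δ_z`. -/
def delta {n : ℕ} (z : Fin n → ℕ) : Hn n := lp.single 2 z 1

/-- `T` is the `i`-th coordinate shift: `T δ_z = δ_{z + e_i}`. -/
def IsShift {n : ℕ} (i : Fin n) (T : Hn n →L[ℂ] Hn n) : Prop :=
  ∀ z : Fin n → ℕ, T (delta z) = delta (Function.update z i (z i + 1))

/-- The Toeplitz algebra `T_n`: the smallest norm-closed star-subalgebra of `B(H_n)`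
containing the coordinate shifts. -/
def Toeplitz (n : ℕ) : StarSubalgebra ℂ (Hn n →L[ℂ] Hn n) :=
  (StarAlgebra.adjoin ℂ {T : Hn n →L[ℂ] Hn n | ∃ i : Fin n, IsShift i T}).topologicalClosure
/-- Padding a matrix by zeros into an `N × N` matrix along an embedding `f`. -/
def padMat {R : Type*} [Semiring R] {ι : Type*} [Fintype ι] {N : ℕ}
    (f : ι ↪ Fin N) (P : Matrix ι ι R) : Matrix (Fin N) (Fin N) R :=
  fun i j => ∑ a : ι, ∑ b : ι, if f a = i ∧ f b = j then P a b else 0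

/-- Equivalence of (idempotent) matrices over a ring `R`: after enlarging by zero diagonal blocks
to a common size `N`, they are conjugate by an invertible `N × N` matrix. -/
def IdemEquiv {R : Type*} [Ring R] {ι κ : Type*} [Fintype ι] [Fintype κ]
    (P : Matrix ι ι R) (Q : Matrix κ κ R) : Prop :=
  ∃ (N : ℕ) (f : ι ↪ Fin N) (g : κ ↪ Fin N) (U : (Matrix (Fin N) (Fin N) R)ˣ),
    U.val * padMat f P * (U⁻¹).val = padMat g Q


/-- The two-sided ideal `J_n` of compact operators in the Toeplitz algebra `T_n`. -/
def compactIdeal (n : ℕ) : TwoSidedIdeal ↥(Toeplitz n) :=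
  TwoSidedIdeal.mk'
    {a : ↥(Toeplitz n) | IsCompactOperator ⇑(a : Hn n →L[ℂ] Hn n)}
    (by
      show IsCompactOperator ⇑(((0 : ↥(Toeplitz n)) : Hn n →L[ℂ] Hn n))
      simp only [ZeroMemClass.coe_zero, ContinuousLinearMap.coe_zero]
      exact isCompactOperator_zero)
    (fun {x y} hx hy => by
      show IsCompactOperator ⇑(((x + y : ↥(Toeplitz n)) : Hn n →L[ℂ] Hn n))
      simp only [AddMemClass.coe_add, ContinuousLinearMap.coe_add']
      exact hx.add hy)
    (fun {x} hx => by
      show IsCompactOperator ⇑(((-x : ↥(Toeplitz n)) : Hn n →L[ℂ] Hn n))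
      simp only [NegMemClass.coe_neg, ContinuousLinearMap.coe_neg']
      exact hx.neg)
    (fun {x y} hy => by
      show IsCompactOperator ⇑(((x * y : ↥(Toeplitz n)) : Hn n →L[ℂ] Hn n))
      have := hy.clm_comp (x : Hn n →L[ℂ] Hn n)
      simpa [Function.comp] using this)
    (fun {x y} hx => by
      show IsCompactOperator ⇑(((x * y : ↥(Toeplitz n)) : Hn n →L[ℂ] Hn n))
      have := hx.comp_clm (y : Hn n →L[ℂ] Hn n)
      simpa [Function.comp] using this)

/-- The quotient ring `A_n = T_n / J_n`, isomorphic to `C(S_H^{2n-1})`. -/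
def QuantumSphere (n : ℕ) : Type := (compactIdeal n).ringCon.Quotient

instance (n : ℕ) : Ring (QuantumSphere n) :=
  inferInstanceAs (Ring (compactIdeal n).ringCon.Quotient)


/-- The quotient map `∂ : T_n → A_n`. -/
def toSphere (n : ℕ) : ↥(Toeplitz n) →+* QuantumSphere n := (compactIdeal n).ringCon.mk'

open scoped Classical in
/-- `Q` is the orthogonal projection onto the closed span of `{δ_z : z_i = 0 for all i ∉ S}`,
characterized by its action on the orthonormal basis. -/
def IsQProj {n : ℕ} (S : Finset (Fin n)) (Q : Hn n →L[ℂ] Hn n) : Prop :=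
  ∀ z : Fin n → ℕ, Q (delta z) = if ∀ i ∉ S, z i = 0 then delta z else 0

/-- The block-diagonal projection `⊞_{S ∈ A} ⊞^{l(S)} q_S` over a ring `R`. -/
def antichainMatR {R : Type*} [Ring R] {n : ℕ}
    (A : Finset (Finset (Fin n))) (l : Finset (Fin n) → ℕ) (q : Finset (Fin n) → R) :
    Matrix ((S : {x // x ∈ A}) × Fin (l S.1)) ((S : {x // x ∈ A}) × Fin (l S.1)) R :=
  Matrix.diagonal fun p => q p.1.1

/-! ### Algebraic equivalence of idempotent matrices -/

theorem padMat_diagonal {R : Type*} [Semiring R] {ι : Type*} [Fintype ι] [DecidableEq ι] {N : ℕ}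
    (f : ι ↪ Fin N) (d : ι → R) :
    padMat f (Matrix.diagonal d) =
      Matrix.diagonal fun i => ∑ a, if f a = i then d a else 0 := by
  ext i j
  simp only [padMat, Matrix.diagonal_apply]
  split_ifs with hij
  · subst hij
    refine Finset.sum_congr rfl fun a _ => ?_
    rw [Finset.sum_eq_single a]
    · simp
    · intro b _ hb
      simp [hb.symm]
    · simp
  · refine Finset.sum_eq_zero fun a _ => Finset.sum_eq_zero fun b _ => ?_
    split_ifs with h1 h2
    · subst h2
      exact absurd (h1.1.symm.trans h1.2) hij
    · rfl
    · rfl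

theorem padMat_eq_submatrix {R : Type*} [Semiring R] {ι κ : Type*} [Fintype ι] {N : ℕ}
    (e : ι ⊕ κ ≃ Fin N) (P : Matrix ι ι R) :
    padMat (Function.Embedding.inl.trans e.toEmbedding) P =
      (Matrix.fromBlocks P 0 0 (0 : Matrix κ κ R)).submatrix e.symm e.symm := by
  classical
  ext i j
  obtain ⟨i, rfl⟩ := e.surjective i
  obtain ⟨j, rfl⟩ := e.surjective j
  rcases i with i | i <;> rcases j with j | j <;>
    simp [padMat, ite_and]

theorem padMat_eq_submatrix_inr {R : Type*} [Semiring R] {ι κ : Type*} [Fintype κ] {N : ℕ}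
    (e : ι ⊕ κ ≃ Fin N) (Q : Matrix κ κ R) :
    padMat (Function.Embedding.inr.trans e.toEmbedding) Q =
      (Matrix.fromBlocks (0 : Matrix ι ι R) 0 0 Q).submatrix e.symm e.symm := by
  classical
  ext i j
  obtain ⟨i, rfl⟩ := e.surjective i
  obtain ⟨j, rfl⟩ := e.surjective j
  rcases i with i | i <;> rcases j with j | j <;>
    simp [padMat, ite_and]

/-- Murray-von Neumann equivalent idempotents become conjugate after enlarging by zeros. -/
theorem IdemEquiv.of_mul_eq {R : Type*} [Ring R] {ι κ : Type*} [Fintype ι] [Fintype κ]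
    {P : Matrix ι ι R} {Q : Matrix κ κ R} (x : Matrix ι κ R) (y : Matrix κ ι R)
    (hxy : x * y = P) (hyx : y * x = Q) (hPx : P * x = x) (hyP : y * P = y) :
    IdemEquiv P Q := by
  classical
  have hxQ : x * Q = x := by rw [← hyx, ← Matrix.mul_assoc, hxy, hPx]
  have hQy : Q * y = y := by rw [← hyx, Matrix.mul_assoc, hxy, hyP]
  have hPP : P * P = P := by nth_rw 2 [← hxy]; rw [← Matrix.mul_assoc, hPx, hxy]
  have hQQ : Q * Q = Q := by nth_rw 2 [← hyx]; rw [← Matrix.mul_assoc, hQy, hyx]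
  let e : ι ⊕ κ ≃ Fin (Fintype.card (ι ⊕ κ)) := Fintype.equivFin _
  let W : Matrix (ι ⊕ κ) (ι ⊕ κ) R := Matrix.fromBlocks (1 - P) x y (1 - Q)
  have hWW : W * W = 1 := by
    simp only [W, Matrix.fromBlocks_multiply, ← Matrix.fromBlocks_one]
    congr 1 <;>
      simp [Matrix.mul_sub, Matrix.sub_mul, hxy, hyx, hPx, hyP, hxQ, hQy, hPP, hQQ]
  have hU : W.submatrix e.symm e.symm * W.submatrix e.symm e.symm = 1 := by
    rw [Matrix.submatrix_mul_equiv, hWW, Matrix.submatrix_one_equiv]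
  refine ⟨_, Function.Embedding.inl.trans e.toEmbedding,
    Function.Embedding.inr.trans e.toEmbedding, ⟨_, _, hU, hU⟩, ?_⟩
  rw [padMat_eq_submatrix, padMat_eq_submatrix_inr]
  show W.submatrix e.symm e.symm * _ * W.submatrix e.symm e.symm = _
  rw [Matrix.submatrix_mul_equiv, Matrix.submatrix_mul_equiv]
  congr 1
  simp only [W, Matrix.fromBlocks_multiply]
  congr 1 <;>
    simp [Matrix.mul_sub, Matrix.sub_mul, hyx, hyP, hPP]

theorem IdemEquiv.diagonal_of_equiv {R : Type*} [Ring R] {ι κ : Type*} [Fintype ι] [Fintype κ]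
    [DecidableEq ι] [DecidableEq κ] (e : ι ≃ κ) {p : ι → R} {q : κ → R}
    (hp : ∀ a, p a * p a = p a) (hpq : ∀ a, q (e a) = p a) :
    IdemEquiv (Matrix.diagonal p) (Matrix.diagonal q) := by
  refine IdemEquiv.of_mul_eq (Matrix.of fun a b => if e a = b then p a else 0)
    (Matrix.of fun b a => if e a = b then p a else 0) ?_ ?_ ?_ ?_
  · ext a a'
    simp only [Matrix.mul_apply, Matrix.diagonal_apply, Matrix.of_apply]
    rw [Finset.sum_eq_single (e a)]
    · by_cases h : a = a'
      · subst h; simp [hp]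
      · have : e a' ≠ e a := fun h' => h (e.injective h').symm
        simp [h, this]
    · intro b _ hb
      simp [hb.symm]
    · simp
  · ext b b'
    simp only [Matrix.mul_apply, Matrix.diagonal_apply, Matrix.of_apply]
    obtain ⟨a, rfl⟩ := e.surjective b
    rw [Finset.sum_eq_single a]
    · by_cases h : e a = b'
      · subst h; simp [hp, hpq]
      · simp [h]
    · intro a' _ ha'
      simp [ha']
    · simp
  · ext a b
    simp [Matrix.diagonal_mul, hp]
  · ext b a
    simp [Matrix.mul_diagonal, hp]

/-- If `q` is equivalent to its complement of `p` in `q`, then finitely many copies of `p`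
are absorbed by a copy of `q`. -/
theorem idemEquiv_absorb {R : Type*} [Ring R] {q p x y : R}
    (hyx : y * x = q) (hxy : x * y = q - p) (hqx : q * x = x) (hyq : y * q = y)
    (hxq : x * q = x)
    (hpp : p * p = p) (hqp : q * p = p) (hpq : p * q = p) (hpx : p * x = 0) (hyp : y * p = 0)
    (hqq : q * q = q) (l l' : ℕ) (hl : 1 ≤ l) :
    IdemEquiv
      (Matrix.fromBlocks (Matrix.diagonal fun _ : Fin l => q) 0 0
        (Matrix.diagonal fun _ : Fin l' => p))
      (Matrix.diagonal fun _ : Fin l => q) := by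
  obtain ⟨l, rfl⟩ : ∃ k, l = k + 1 := ⟨l - 1, by omega⟩
  have hqxp : ∀ t, q * x ^ t * q = x ^ t * q := by
    intro t
    induction t with
    | zero => simp [hqq]
    | succ t ih => rw [pow_succ', ← mul_assoc, hqx]
  have hqyp : ∀ t, q * y ^ t * q = q * y ^ t := by
    intro t
    induction t with
    | zero => simp [hqq]
    | succ t ih => rw [pow_succ, mul_assoc, mul_assoc, hyq]
  have hyxp : ∀ t, q * y ^ t * (x ^ t * q) = q := by
    intro t
    induction t with
    | zero => simp [hqq]
    | succ t ih =>
      have : q * y ^ (t + 1) * (x ^ (t + 1) * q) = q * y ^ t * q * (x ^ t * q) := by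
        rw [pow_succ, pow_succ', ← hyx]; simp only [mul_assoc]
      rw [this, hqyp, ih]
  have hyxlt : ∀ s t, q * y ^ (s + t + 1) * (x ^ t * p) = 0 := by
    intro s t
    have h1 : q * y ^ (s + t + 1) * (x ^ t * p) =
        q * (y ^ (s + 1) * (q * y ^ t * (x ^ t * q))) * p := by
      have : y ^ (s + 1) * q = y ^ (s + 1) := by rw [pow_succ, mul_assoc, hyq]
      have h2 : y ^ (s + 1) * (q * y ^ t * (x ^ t * q)) = y ^ (s + t + 1) * (x ^ t * q) := by
        rw [mul_assoc, ← mul_assoc, this, show s + t + 1 = (s + 1) + t by ring, pow_add y (s + 1)]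
        simp only [mul_assoc]
      rw [h2]
      simp only [mul_assoc, hqp]
    rw [h1, hyxp, pow_succ, mul_assoc (y ^ s), hyq, mul_assoc, mul_assoc, hyp]
    simp
  have hpxlt : ∀ s t, p * y ^ t * (x ^ (s + t + 1) * q) = 0 := by
    intro s t
    have h2 : p * y ^ t * (x ^ (s + t + 1) * q) =
        p * (q * y ^ t * (x ^ t * q)) * x ^ (s + 1) * q := by
      have hq : q * (x ^ (s + 1) * q) = x ^ (s + 1) * q := by rw [← mul_assoc, hqxp]
      rw [show s + t + 1 = t + (s + 1) by ring, pow_add]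
      simp only [mul_assoc, hq]
      rw [← mul_assoc p q, hpq]
    rw [h2, hyxp, hpq, pow_succ', ← mul_assoc, hpx]
    simp
  have hpyxp : ∀ s t : ℕ, p * y ^ s * (x ^ t * p) = if s = t then p else 0 := by
    intro s t
    have hL : p * y ^ s * (x ^ t * p) = p * (q * y ^ s * (x ^ t * p)) := by
      rw [mul_assoc q, ← mul_assoc p q, hpq, mul_assoc]
    have hR : p * y ^ s * (x ^ t * p) = p * y ^ s * (x ^ t * q) * p := by
      rw [mul_assoc (p * y ^ s), mul_assoc (x ^ t), hqp]
    split_ifs with h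
    · subst h
      have : q * y ^ s * (x ^ s * p) = q * y ^ s * (x ^ s * q) * p := by
        simp only [mul_assoc, hqp]
      rw [hL, this, hyxp, hqp, hpp]
    · rcases lt_or_gt_of_ne h with h | h
      · obtain ⟨k, rfl⟩ : ∃ k, t = k + s + 1 := ⟨t - s - 1, by omega⟩
        rw [hR, hpxlt, zero_mul]
      · obtain ⟨k, rfl⟩ : ∃ k, s = k + t + 1 := ⟨s - t - 1, by omega⟩
        rw [hL, hyxlt, mul_zero]
  have hsum : ∀ t : ℕ,
      x ^ t * q * (q * y ^ t) + ∑ b ∈ Finset.range t, x ^ b * p * (p * y ^ b) = q := by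
    intro t
    induction t with
    | zero => simp [hqq]
    | succ t ih =>
      have h1 : x ^ (t + 1) * q * (q * y ^ (t + 1)) =
          x ^ t * q * (q * y ^ t) - x ^ t * p * (p * y ^ t) := by
        have : x ^ (t + 1) * q * (q * y ^ (t + 1)) = x ^ t * (x * q * q * y) * y ^ t := by
          rw [pow_succ x, pow_succ' y]; simp only [mul_assoc]
        rw [this, hxq, hxq, hxy, mul_sub, sub_mul, ← mul_assoc (x ^ t * q) q,
          mul_assoc (x ^ t) q q, hqq, ← mul_assoc (x ^ t * p) p, mul_assoc (x ^ t) p p, hpp]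
      rw [Finset.sum_range_succ, h1]
      nth_rw 3 [← ih]
      abel
  let X : Matrix (Fin (l + 1)) (Fin (l + 1) ⊕ Fin l') R := Matrix.fromCols
    (Matrix.diagonal fun a => if a = 0 then x ^ l' * q else q)
    (Matrix.of fun a b => if a = 0 then x ^ (b : ℕ) * p else 0)
  let Y : Matrix (Fin (l + 1) ⊕ Fin l') (Fin (l + 1)) R := Matrix.fromRows
    (Matrix.diagonal fun a => if a = 0 then q * y ^ l' else q)
    (Matrix.of fun b a => if a = 0 then p * y ^ (b : ℕ) else 0)
  have hYX : Y * X = Matrix.fromBlocks (Matrix.diagonal fun _ : Fin (l + 1) => q) 0 0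
        (Matrix.diagonal fun _ : Fin l' => p) := by
    simp only [X, Y]
    rw [Matrix.fromRows_mul_fromCols]
    congr 1
    · rw [Matrix.diagonal_mul_diagonal]
      congr 1
      ext a
      split_ifs
      · exact hyxp l'
      · exact hqq
    · ext a b
      rw [Matrix.diagonal_mul]
      by_cases ha : a = 0
      · obtain ⟨k, hk⟩ : ∃ k, l' = k + b + 1 := ⟨l' - b - 1, by omega⟩
        simp only [ha, if_true, Matrix.zero_apply, Matrix.of_apply]
        rw [show y ^ l' = y ^ (k + b + 1) from congrArg _ hk]
        exact hyxlt k b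
      · simp [ha]
    · ext b a
      rw [Matrix.mul_diagonal]
      by_cases ha : a = 0
      · obtain ⟨k, hk⟩ : ∃ k, l' = k + b + 1 := ⟨l' - b - 1, by omega⟩
        simp only [ha, if_true, Matrix.zero_apply, Matrix.of_apply]
        rw [show x ^ l' = x ^ (k + b + 1) from congrArg _ hk]
        exact hpxlt k b
      · simp [ha]
    · ext b b'
      rw [Matrix.mul_apply, Finset.sum_eq_single 0]
      · simp only [Matrix.of_apply, if_true, hpyxp, Matrix.diagonal_apply, Fin.ext_iff]
      · intro a _ ha
        simp [ha]
      · simp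
  have hXY : X * Y = Matrix.diagonal fun _ : Fin (l + 1) => q := by
    simp only [X, Y]
    rw [Matrix.fromCols_mul_fromRows, Matrix.diagonal_mul_diagonal]
    ext a a'
    rw [Matrix.add_apply, Matrix.mul_apply]
    by_cases h : a = a'
    · subst h
      by_cases ha : a = 0
      · subst ha
        simpa [Finset.sum_range] using hsum l'
      · simp [ha, hqq]
    · by_cases ha : a = 0
      · have : a' ≠ 0 := fun h' => h (ha.trans h'.symm)
        simp [h, this]
      · simp [h, ha]
  refine IdemEquiv.of_mul_eq Y X hYX hXY ?_ ?_
  · rw [← hYX, Matrix.mul_assoc, hXY]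
    ext i a
    rcases i with i | i
    · by_cases h : i = a
      · subst h
        by_cases ha : i = 0 <;> simp [Y, Matrix.mul_diagonal, ha, hqyp, hqq]
      · simp [Y, Matrix.mul_diagonal, h]
    · by_cases ha : a = 0
      · simp only [Y, Matrix.mul_diagonal, ha, Matrix.fromRows_apply_inr,
          Matrix.of_apply, if_true]
        have := hqyp i
        calc p * y ^ (i : ℕ) * q = p * (q * y ^ (i : ℕ) * q) := by
              simp only [← mul_assoc, hpq]
          _ = _ := by rw [this, ← mul_assoc, hpq]
      · simp [Y, Matrix.mul_diagonal, ha]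
  · rw [← hYX, ← Matrix.mul_assoc, hXY]
    ext a i
    rcases i with i | i
    · by_cases h : a = i
      · subst h
        by_cases ha : a = 0
        · simp [X, Matrix.diagonal_mul, ha, ← mul_assoc, hqxp]
        · simp [X, Matrix.diagonal_mul, ha, hqq]
      · simp [X, Matrix.diagonal_mul, h]
    · by_cases ha : a = 0
      · simp only [X, Matrix.diagonal_mul, ha, Matrix.fromCols_apply_inr,
          Matrix.of_apply, if_true]
        have := hqxp i
        calc q * (x ^ (i : ℕ) * p) = q * x ^ (i : ℕ) * q * p := by
              simp only [mul_assoc, hqp]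
          _ = _ := by rw [this, mul_assoc, hqp]
      · simp [X, Matrix.diagonal_mul, ha]

/-! ### Ranks of diagonal matrices of endomorphisms -/

theorem rank_pi_fin {𝕜 : Type} [Field 𝕜] {N : ℕ} (M : Fin N → Type)
    [∀ i, AddCommGroup (M i)] [∀ i, Module 𝕜 (M i)] :
    Module.rank 𝕜 (∀ i, M i) = ∑ i, Module.rank 𝕜 (M i) := by
  induction N with
  | zero => simp
  | succ N ih =>
    rw [← (Fin.consLinearEquiv 𝕜 M).rank_eq, rank_prod', ih, Fin.sum_univ_succ]

theorem rank_endVec_diagonal {𝕜 K : Type} [Field 𝕜] [AddCommGroup K] [Module 𝕜 K] {N : ℕ}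
    (D : Fin N → Module.End 𝕜 K) :
    LinearMap.rank ((endVecRingEquivMatrixEnd (Fin N) 𝕜 K).symm (Matrix.diagonal D)) =
      ∑ i, LinearMap.rank (D i) := by
  set F := (endVecRingEquivMatrixEnd (Fin N) 𝕜 K).symm (Matrix.diagonal D) with hF
  have happ : ∀ x i, F x i = D i (x i) := by
    intro x i
    change ∑ j, Matrix.diagonal D i j (x j) = _
    rw [Finset.sum_eq_single i]
    · simp
    · intro j _ hj
      simp [Matrix.diagonal_apply_ne _ hj.symm]
    · simp
  let G : (∀ i, LinearMap.range (D i)) →ₗ[𝕜] (Fin N → K) :=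
    LinearMap.pi fun i => (LinearMap.range (D i)).subtype ∘ₗ LinearMap.proj i
  have hG : Function.Injective G := fun x y hxy => by
    ext i
    exact congrFun hxy i
  have hrange : LinearMap.range F = LinearMap.range G := by
    ext x
    constructor
    · rintro ⟨y, rfl⟩
      exact ⟨fun i => ⟨D i (y i), y i, rfl⟩, funext fun i => (happ y i).symm⟩
    · rintro ⟨y, rfl⟩
      choose z hz using fun i => (y i).2
      exact ⟨z, funext fun i => (happ z i).trans (hz i)⟩
  rw [LinearMap.rank, hrange, rank_range_of_injective G hG]
  exact rank_pi_fin _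

theorem rank_conj_eq {𝕜 V : Type} [Field 𝕜] [AddCommGroup V] [Module 𝕜 V]
    {P Q u v : Module.End 𝕜 V} (hvu : v * u = 1) (h : u * P * v = Q) :
    LinearMap.rank P = LinearMap.rank Q := by
  apply le_antisymm
  · have : P = v * Q * u := by
      rw [← h]
      calc P = (v * u) * P * (v * u) := by rw [hvu]; simp
        _ = _ := by simp only [mul_assoc]
    rw [this]
    exact (LinearMap.rank_comp_le_left u (v * Q)).trans (LinearMap.rank_comp_le_right Q v)
  · rw [← h]
    exact (LinearMap.rank_comp_le_left v (u * P)).trans (LinearMap.rank_comp_le_right P u)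

theorem IdemEquiv.sum_rank_eq {R : Type*} [Ring R] {ι κ : Type} [Fintype ι] [Fintype κ]
    [DecidableEq ι] [DecidableEq κ] {𝕜 K : Type} [Field 𝕜] [AddCommGroup K] [Module 𝕜 K]
    (φ : R →+* Module.End 𝕜 K) {p : ι → R} {q : κ → R}
    (h : IdemEquiv (Matrix.diagonal p) (Matrix.diagonal q)) :
    ∑ a, LinearMap.rank (φ (p a)) = ∑ b, LinearMap.rank (φ (q b)) := by
  obtain ⟨N, f, g, U, hU⟩ := h
  have key : ∀ {ι : Type} [Fintype ι] [DecidableEq ι] (f : ι ↪ Fin N) (p : ι → R),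
      ∑ i, LinearMap.rank (φ (∑ a, if f a = i then p a else 0)) =
        ∑ a, LinearMap.rank (φ (p a)) := by
    intro ι _ _ f p
    rw [← Finset.sum_subset (Finset.subset_univ (Finset.univ.map f)), Finset.sum_map]
    · refine Finset.sum_congr rfl fun a _ => ?_
      simp
    · intro i _ hi
      have : ∀ a, f a ≠ i := by simpa using hi
      simp [this]
  let Ψ : Matrix (Fin N) (Fin N) R →+* Module.End 𝕜 (Fin N → K) :=
    (endVecRingEquivMatrixEnd (Fin N) 𝕜 K).symm.toRingHom.comp φ.mapMatrix
  have hΨ : ∀ d : Fin N → R, LinearMap.rank (Ψ (Matrix.diagonal d)) =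
      ∑ i, LinearMap.rank (φ (d i)) := by
    intro d
    rw [← rank_endVec_diagonal]
    simp [Ψ, Matrix.diagonal_map]
  rw [← key f, ← key g, ← hΨ, ← hΨ, ← padMat_diagonal, ← padMat_diagonal]
  refine rank_conj_eq (u := Ψ U.val) (v := Ψ (U⁻¹).val) ?_ ?_
  · rw [← map_mul, Units.inv_mul, map_one]
  · rw [← map_mul, ← map_mul, hU]

/-! ### The standard basis, shifts and coordinate projections -/

theorem inner_delta {n : ℕ} (z : Fin n → ℕ) (x : Hn n) : inner ℂ (delta z) x = x z := by
  simp [delta, lp.inner_single_left]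

theorem delta_apply {n : ℕ} (z w : Fin n → ℕ) : delta z w = if z = w then 1 else 0 := by
  simp [delta, lp.single_apply, Pi.single_apply, eq_comm]

theorem inner_delta_delta {n : ℕ} (z w : Fin n → ℕ) :
    inner ℂ (delta z) (delta w) = if z = w then (1 : ℂ) else 0 := by
  rw [inner_delta, delta_apply]
  simp only [eq_comm]

theorem dense_span_delta (n : ℕ) :
    Dense (Submodule.span ℂ (Set.range (delta : (Fin n → ℕ) → Hn n)) : Set (Hn n)) := by
  intro x
  have hx : HasSum (fun z => lp.single 2 z (x z)) x := lp.hasSum_single (by simp) x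
  refine mem_closure_of_tendsto hx (Filter.Eventually.of_forall fun s => ?_)
  refine Submodule.sum_mem _ fun z _ => ?_
  have : lp.single 2 z (x z) = x z • (delta z : Hn n) := by
    rw [delta, ← lp.single_smul]
    simp
  rw [this]
  exact Submodule.smul_mem _ _ (Submodule.subset_span ⟨z, rfl⟩)

theorem clm_ext_delta {n : ℕ} {A B : Hn n →L[ℂ] Hn n} (h : ∀ z, A (delta z) = B (delta z)) :
    A = B :=
  ContinuousLinearMap.ext_on (dense_span_delta n) (by rintro _ ⟨z, rfl⟩; exact h z)

/-- Translation of a lattice point by the `i`-th standard basis vector. -/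
def bump {n : ℕ} (i : Fin n) (z : Fin n → ℕ) : Fin n → ℕ := Function.update z i (z i + 1)

theorem bump_injective {n : ℕ} (i : Fin n) : Function.Injective (bump i) := by
  intro z w h
  ext j
  have hj := congrFun h j
  by_cases hji : j = i
  · subst hji
    simpa [bump] using hj
  · simpa [bump, hji] using hj

theorem exists_eq_bump {n : ℕ} {i : Fin n} {z : Fin n → ℕ} (h : z i ≠ 0) :
    ∃ w, z = bump i w := by
  refine ⟨Function.update z i (z i - 1), ?_⟩
  ext j
  by_cases hji : j = i
  · subst hji
    simp [bump]
    omega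
  · simp [bump, hji]

theorem exists_isShift {n : ℕ} (i : Fin n) : ∃ T : Hn n →L[ℂ] Hn n, IsShift i T := by
  have hv : Orthonormal ℂ (fun z : Fin n → ℕ => (delta (bump i z) : Hn n)) := by
    rw [orthonormal_iff_ite]
    intro z w
    rw [inner_delta_delta]
    simp [(bump_injective i).eq_iff]
  refine ⟨hv.orthogonalFamily.linearIsometry.toContinuousLinearMap, fun z => ?_⟩
  simp [delta, bump]

section Shift

variable {n : ℕ} {i : Fin n} {T : Hn n →L[ℂ] Hn n}

theorem IsShift.mem_toeplitz (hT : IsShift i T) : T ∈ Toeplitz n :=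
  StarSubalgebra.le_topologicalClosure _ (StarAlgebra.subset_adjoin ℂ _ ⟨i, hT⟩)

theorem IsShift.apply_delta (hT : IsShift i T) (z : Fin n → ℕ) : T (delta z) = delta (bump i z) :=
  hT z

theorem IsShift.star_mul_self (hT : IsShift i T) : star T * T = 1 := by
  refine clm_ext_delta fun z => ?_
  ext y
  rw [← inner_delta, ContinuousLinearMap.star_eq_adjoint, mul_apply_eq_comp,
    ContinuousLinearMap.adjoint_inner_right, hT.apply_delta, hT.apply_delta, inner_delta_delta,
    one_apply_eq_self, delta_apply]
  simp [(bump_injective i).eq_iff, eq_comm]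

theorem IsShift.star_apply_bump (hT : IsShift i T) (z : Fin n → ℕ) :
    star T (delta (bump i z)) = delta z := by
  rw [← hT.apply_delta, ← mul_apply_eq_comp, hT.star_mul_self,
    one_apply_eq_self]

theorem IsShift.star_apply_of_eq_zero (hT : IsShift i T) {z : Fin n → ℕ} (hz : z i = 0) :
    star T (delta z) = 0 := by
  ext y
  rw [← inner_delta, ContinuousLinearMap.star_eq_adjoint,
    ContinuousLinearMap.adjoint_inner_right, hT.apply_delta, inner_delta_delta, if_neg]
  · rfl
  · rintro rfl
    simp [bump] at hz

/-- Membership of a lattice point in the face of `ℕ^n` spanned by `S`. -/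
def InFace (S : Finset (Fin n)) (z : Fin n → ℕ) : Prop := ∀ i ∉ S, z i = 0

theorem inFace_bump_iff {S : Finset (Fin n)} (hi : i ∈ S) (z : Fin n → ℕ) :
    InFace S (bump i z) ↔ InFace S z := by
  refine forall₂_congr fun j hj => ?_
  have : j ≠ i := fun h => hj (h ▸ hi)
  simp [bump, this]

theorem not_inFace_bump {S : Finset (Fin n)} (hi : i ∉ S) (z : Fin n → ℕ) :
    ¬ InFace S (bump i z) := fun h => by
  simpa [bump] using h i hi

theorem InFace.mono {S S' : Finset (Fin n)} (h : S' ⊆ S) {z : Fin n → ℕ} (hz : InFace S' z) :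
    InFace S z := fun j hj => hz j fun hj' => hj (h hj')

variable {S S' : Finset (Fin n)} {Q Q' : Hn n →L[ℂ] Hn n}

theorem IsQProj.apply_of_inFace (hQ : IsQProj S Q) {z : Fin n → ℕ} (hz : InFace S z) :
    Q (delta z) = delta z := (hQ z).trans (if_pos hz)

theorem IsQProj.apply_of_not_inFace (hQ : IsQProj S Q) {z : Fin n → ℕ} (hz : ¬ InFace S z) :
    Q (delta z) = 0 := (hQ z).trans (if_neg hz)

theorem IsQProj.mul_of_subset (hQ : IsQProj S Q) (hQ' : IsQProj S' Q') (h : S' ⊆ S) :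
    Q * Q' = Q' := by
  refine clm_ext_delta fun z => ?_
  by_cases hz : InFace S' z
  · simp [hQ'.apply_of_inFace hz, hQ.apply_of_inFace (hz.mono h)]
  · simp [hQ'.apply_of_not_inFace hz]

theorem IsQProj.mul_of_subset' (hQ : IsQProj S Q) (hQ' : IsQProj S' Q') (h : S' ⊆ S) :
    Q' * Q = Q' := by
  refine clm_ext_delta fun z => ?_
  by_cases hz : InFace S z
  · simp [hQ.apply_of_inFace hz]
  · have : ¬ InFace S' z := fun h' => hz (h'.mono h)
    simp [hQ.apply_of_not_inFace hz, hQ'.apply_of_not_inFace this]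

theorem IsQProj.commute_shift (hQ : IsQProj S Q) (hT : IsShift i T) (hi : i ∈ S) :
    Commute Q T := by
  refine clm_ext_delta fun z => ?_
  by_cases hz : InFace S z
  · simp [hT.apply_delta, hQ.apply_of_inFace hz,
      hQ.apply_of_inFace ((inFace_bump_iff hi z).2 hz)]
  · simp [hT.apply_delta, hQ.apply_of_not_inFace hz,
      hQ.apply_of_not_inFace (mt (inFace_bump_iff hi z).1 hz)]

theorem IsQProj.mul_shift_eq_zero (hQ : IsQProj S Q) (hT : IsShift i T) (hi : i ∉ S) :
    Q * T = 0 := by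
  refine clm_ext_delta fun z => ?_
  simp [hT.apply_delta, hQ.apply_of_not_inFace (not_inFace_bump hi z)]

theorem IsQProj.star_eq (hQ : IsQProj S Q) : star Q = Q := by
  refine clm_ext_delta fun z => ?_
  ext y
  rw [← inner_delta, ContinuousLinearMap.star_eq_adjoint,
    ContinuousLinearMap.adjoint_inner_right, ← inner_delta]
  by_cases hz : InFace S z <;> by_cases hy : InFace S y
  · rw [hQ.apply_of_inFace hz, hQ.apply_of_inFace hy]
  · rw [hQ.apply_of_inFace hz, hQ.apply_of_not_inFace hy, inner_delta_delta, if_neg]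
    · simp
    · rintro rfl
      exact hy hz
  · rw [hQ.apply_of_inFace hy, hQ.apply_of_not_inFace hz, inner_delta_delta, if_neg]
    · simp
    · rintro rfl
      exact hz hy
  · rw [hQ.apply_of_not_inFace hy, hQ.apply_of_not_inFace hz]
    simp

theorem IsQProj.mul_shift_mul_star (hQ : IsQProj (insert i S') Q) (hQ' : IsQProj S' Q')
    (hT : IsShift i T) (hi : i ∉ S') : Q * (T * star T) = Q - Q' := by
  refine clm_ext_delta fun z => ?_
  by_cases hz : z i = 0
  · have hiff : InFace (insert i S') z ↔ InFace S' z := by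
      refine ⟨fun h j hj => ?_, fun h => h.mono (Finset.subset_insert _ _)⟩
      by_cases hji : j = i
      · rw [hji, hz]
      · exact h j (by simp [hji, hj])
    by_cases hf : InFace S' z
    · simp [hT.star_apply_of_eq_zero hz, hQ'.apply_of_inFace hf,
        hQ.apply_of_inFace (hiff.2 hf)]
    · simp [hT.star_apply_of_eq_zero hz, hQ'.apply_of_not_inFace hf,
        hQ.apply_of_not_inFace (mt hiff.1 hf)]
  · obtain ⟨w, rfl⟩ := exists_eq_bump hz
    simp [hT.star_apply_bump, hT.apply_delta, hQ'.apply_of_not_inFace (not_inFace_bump hi w)]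

end Shift

/-- The partial isometry shifting the face of `insert i S'` off the face of `S'` realizes the
absorption of `p` by `q`. -/
theorem absorb_relations {R : Type*} [Ring R] {q r p t s : R}
    (hqq : q * q = q) (hqr : q * r = r) (hrq : r * q = r) (hrr : r * r = r)
    (hpq : p * q = p) (hqp : q * p = p) (hpr : p * r = p) (hrp : r * p = p)
    (hqt : Commute q t) (hqs : Commute q s) (hrt : Commute r t) (hrs : Commute r s)
    (hst : s * t = 1) (hrts : r * (t * s) = r - p) (hpt : p * t = 0) (hsp : s * p = 0) :
    let x := q - r + t * r
    let y := q - r + s * r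
    y * x = q ∧ x * y = q - p ∧ q * x = x ∧ y * q = y ∧ x * q = x ∧ p * x = 0 ∧ y * p = 0 := by
  have hqtr : q * (t * r) = t * r := by rw [← mul_assoc, hqt.eq, mul_assoc, hqr]
  have hqsr : q * (s * r) = s * r := by rw [← mul_assoc, hqs.eq, mul_assoc, hqr]
  have hrtr : r * (t * r) = t * r := by rw [← mul_assoc, hrt.eq, mul_assoc, hrr]
  have hrsr : r * (s * r) = s * r := by rw [← mul_assoc, hrs.eq, mul_assoc, hrr]
  have hptr : p * (t * r) = 0 := by rw [← mul_assoc, hpt, zero_mul]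
  have h1 : s * (t * r) = r := by rw [← mul_assoc, hst, one_mul]
  have h2 : t * (s * r) = r - p := by
    rw [← mul_assoc, ← hrts, (hrt.mul_right hrs).eq]
  dsimp only
  refine ⟨?_, ?_, ?_, ?_, ?_, ?_, ?_⟩ <;>
    simp only [mul_add, add_mul, mul_sub, sub_mul, mul_assoc, hqq, hqr, hrq, hrr, hpq, hqp, hpr,
      hrp, hqtr, hqsr, hrtr, hrsr, hptr, h1, h2, hsp] <;> abel


/-! ### Absorption in the quotient algebra -/

section Sphere

variable {n : ℕ} {S S' : Finset (Fin n)}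

theorem idemEquiv_absorb_qProj (Q : Finset (Fin n) → (Hn n →L[ℂ] Hn n))
    (hQ : ∀ S, IsQProj S (Q S)) (hmem : ∀ S, Q S ∈ Toeplitz n) (h : S' ⊂ S) (l l' : ℕ)
    (hl : 1 ≤ l) :
    IdemEquiv
      (Matrix.fromBlocks
        (Matrix.diagonal fun _ : Fin l => toSphere n ⟨Q S, hmem S⟩)
        0 0
        (Matrix.diagonal fun _ : Fin l' => toSphere n ⟨Q S', hmem S'⟩))
      (Matrix.diagonal fun _ : Fin l => toSphere n ⟨Q S, hmem S⟩) := by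
  have hsub := h.subset
  obtain ⟨j, hjS, hj⟩ := Finset.exists_of_ssubset h
  have hR : insert j S' ⊆ S := Finset.insert_subset hjS hsub
  have hS'R : S' ⊆ insert j S' := Finset.subset_insert _ _
  obtain ⟨T, hT⟩ := exists_isShift j
  have hq := hQ S
  have hr := hQ (insert j S')
  have hp := hQ S'
  have hqt := hq.commute_shift hT hjS
  have hrt := hr.commute_shift hT (Finset.mem_insert_self j S')
  have hqs : Commute (Q S) (star T) := by
    have := hqt.star_star
    rwa [hq.star_eq] at this
  have hrs : Commute (Q (insert j S')) (star T) := by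
    have := hrt.star_star
    rwa [hr.star_eq] at this
  have hsp : star T * Q S' = 0 := by
    have := congrArg star (hp.mul_shift_eq_zero hT hj)
    rwa [star_mul, hp.star_eq, star_zero] at this
  let t : Toeplitz n := ⟨T, hT.mem_toeplitz⟩
  let q (S : Finset (Fin n)) : Toeplitz n := ⟨Q S, hmem S⟩
  have key := absorb_relations (q := q S) (r := q (insert j S')) (p := q S') (t := t) (s := star t)
    (Subtype.ext (hq.mul_of_subset hq subset_rfl)) (Subtype.ext (hq.mul_of_subset hr hR))
    (Subtype.ext (hq.mul_of_subset' hr hR)) (Subtype.ext (hr.mul_of_subset hr subset_rfl))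
    (Subtype.ext (hq.mul_of_subset' hp hsub)) (Subtype.ext (hq.mul_of_subset hp hsub))
    (Subtype.ext (hr.mul_of_subset' hp hS'R)) (Subtype.ext (hr.mul_of_subset hp hS'R))
    (Subtype.ext hqt) (Subtype.ext hqs) (Subtype.ext hrt) (Subtype.ext hrs)
    (Subtype.ext hT.star_mul_self) (Subtype.ext (hr.mul_shift_mul_star hp hT hj))
    (Subtype.ext (hp.mul_shift_eq_zero hT hj)) (Subtype.ext hsp)
  obtain ⟨h1, h2, h3, h4, h5, h6, h7⟩ := key
  have hqq : q S * q S = q S := Subtype.ext (hq.mul_of_subset hq subset_rfl)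
  have hpp : q S' * q S' = q S' := Subtype.ext (hp.mul_of_subset hp subset_rfl)
  have hqp : q S * q S' = q S' := Subtype.ext (hq.mul_of_subset hp hsub)
  have hpq : q S' * q S = q S' := Subtype.ext (hq.mul_of_subset' hp hsub)
  replace h1 := congrArg (toSphere n) h1
  replace h2 := congrArg (toSphere n) h2
  replace h3 := congrArg (toSphere n) h3
  replace h4 := congrArg (toSphere n) h4
  replace h5 := congrArg (toSphere n) h5
  replace h6 := congrArg (toSphere n) h6
  replace h7 := congrArg (toSphere n) h7
  replace hqq := congrArg (toSphere n) hqq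
  replace hpp := congrArg (toSphere n) hpp
  replace hqp := congrArg (toSphere n) hqp
  replace hpq := congrArg (toSphere n) hpq
  rw [map_mul] at h1 h2 h3 h4 h5 h6 h7 hqq hpp hqp hpq
  rw [map_sub] at h2
  rw [map_zero] at h6 h7
  exact idemEquiv_absorb h1 h2 h3 h4 h5 hpp hqp hpq h6 h7 hqq l l' hl

theorem idemEquiv_antichainMatR_of_eq {R : Type*} [Ring R] (A : Finset (Finset (Fin n)))
    {l l' : Finset (Fin n) → ℕ} (hl : ∀ S ∈ A, l S = l' S) {q : Finset (Fin n) → R}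
    (hq : ∀ S, q S * q S = q S) : IdemEquiv (antichainMatR A l q) (antichainMatR A l' q) :=
  IdemEquiv.diagonal_of_equiv
    (Equiv.sigmaCongrRight fun S : {x // x ∈ A} => finCongr (hl S.1 S.2))
    (fun _ => hq _) fun _ => rfl

end Sphere

/-! ### Almost invariant vectors -/

section Folner

variable {n : ℕ}

/-- The sum of the basis vectors indexed by a finite set of lattice points. -/
def indVec (F : Finset (Fin n → ℕ)) : Hn n := ∑ z ∈ F, delta z

theorem inner_indVec (F G : Finset (Fin n → ℕ)) :
    inner ℂ (indVec F) (indVec G) = ((F ∩ G).card : ℂ) := by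
  simp only [indVec, sum_inner, inner_sum, inner_delta_delta]
  simp [Finset.sum_ite_mem, Finset.inter_comm]

theorem inner_delta_indVec (z : Fin n → ℕ) (F : Finset (Fin n → ℕ)) :
    inner ℂ (delta z) (indVec F) = if z ∈ F then (1 : ℂ) else 0 := by
  simp only [indVec, inner_sum, inner_delta_delta]
  simp

/-- Side lengths of the boxes `box S k w`. -/
def side (S : Finset (Fin n)) (k : ℕ) (i : Fin n) : ℕ := if i ∈ S then k + 1 else 1

/-- The box with corner `w` that has `k + 1` points in the directions of `S` and one point in the
other directions. -/
def box (S : Finset (Fin n)) (k : ℕ) (w : Fin n → ℕ) : Finset (Fin n → ℕ) :=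
  Fintype.piFinset fun i => Finset.Ico (w i) (w i + side S k i)

/-- The number of points of the boxes `box S k w`. -/
def vol (S : Finset (Fin n)) (k : ℕ) : ℕ := ∏ i, side S k i

theorem mem_box {S : Finset (Fin n)} {k : ℕ} {w z : Fin n → ℕ} :
    z ∈ box S k w ↔ ∀ i, w i ≤ z i ∧ z i < w i + side S k i := by
  simp [box]

theorem card_box (S : Finset (Fin n)) (k : ℕ) (w : Fin n → ℕ) : (box S k w).card = vol S k := by
  simp [box, vol]

theorem side_pos (S : Finset (Fin n)) (k : ℕ) (i : Fin n) : 0 < side S k i := by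
  unfold side
  split_ifs <;> omega

theorem vol_pos (S : Finset (Fin n)) (k : ℕ) : 0 < vol S k :=
  Finset.prod_pos fun i _ => side_pos S k i

theorem succ_le_vol {S : Finset (Fin n)} (hS : S.Nonempty) (k : ℕ) : k + 1 ≤ vol S k := by
  obtain ⟨i, hi⟩ := hS
  calc k + 1 = side S k i := by simp [side, hi]
    _ ≤ vol S k := Finset.single_le_prod' (fun j _ => side_pos S k j) (Finset.mem_univ i)

theorem eq_of_mem_box {S : Finset (Fin n)} {k : ℕ} {w z : Fin n → ℕ} (hz : z ∈ box S k w)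
    {i : Fin n} (hi : i ∉ S) : z i = w i := by
  have := mem_box.1 hz i
  simp only [side, hi, if_false] at this
  omega

theorem card_box_inter_bump {S : Finset (Fin n)} {i : Fin n} (hi : i ∈ S) (k : ℕ)
    (w : Fin n → ℕ) : (box S k (bump i w) ∩ box S k w).card * (k + 1) = k * vol S k := by
  have : box S k (bump i w) ∩ box S k w =
      Fintype.piFinset (Function.update (fun j => Finset.Ico (w j) (w j + side S k j)) i
        (Finset.Ico (w i + 1) (w i + 1 + k))) := by
    ext z
    simp only [Finset.mem_inter, mem_box, Fintype.mem_piFinset, ← forall_and]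
    refine forall_congr' fun j => ?_
    by_cases hj : j = i
    · subst hj
      simp [bump, side, hi]
      omega
    · simp [bump, hj]
  have h2 : (box S k (bump i w) ∩ box S k w).card = k * ∏ j ∈ Finset.univ \ {i}, side S k j := by
    rw [this, Fintype.card_piFinset]
    have h3 : (fun j => (Function.update (fun j => Finset.Ico (w j) (w j + side S k j)) i
        (Finset.Ico (w i + 1) (w i + 1 + k)) j).card) = Function.update (side S k) i k := by
      ext j
      by_cases hj : j = i
      · subst hj
        simp
      · simp [hj]
    rw [h3, Finset.prod_update_of_mem (Finset.mem_univ i)]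
  have h4 : vol S k = side S k i * ∏ j ∈ Finset.univ \ {i}, side S k j := by
    rw [vol, Finset.prod_eq_mul_prod_sdiff_singleton_of_mem (Finset.mem_univ i)]
  rw [h2, h4, side, if_pos hi]
  ring

/-- The normalized indicator vector of `box S k w`. -/
def boxVec (S : Finset (Fin n)) (w : Fin n → ℕ) (k : ℕ) : Hn n :=
  ((√(vol S k : ℝ))⁻¹ : ℂ) • indVec (box S k w)

theorem inner_boxVec (S : Finset (Fin n)) (w w' : Fin n → ℕ) (k : ℕ) :
    inner ℂ (boxVec S w k) (boxVec S w' k) =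
      ((box S k w ∩ box S k w').card : ℂ) / (vol S k : ℂ) := by
  have h : ((√(vol S k : ℝ) : ℝ) : ℂ) * (√(vol S k : ℝ) : ℝ) = (vol S k : ℂ) := by
    rw [← Complex.ofReal_mul, Real.mul_self_sqrt (Nat.cast_nonneg _)]
    simp
  simp only [boxVec, inner_smul_left, inner_smul_right, inner_indVec, map_inv₀, Complex.conj_ofReal]
  rw [← mul_assoc, ← mul_inv, h, div_eq_mul_inv, mul_comm]

theorem inner_boxVec_self (S : Finset (Fin n)) (w : Fin n → ℕ) (k : ℕ) :
    inner ℂ (boxVec S w k) (boxVec S w k) = (1 : ℂ) := by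
  rw [inner_boxVec, Finset.inter_self, card_box, div_self]
  exact_mod_cast (vol_pos S k).ne'

theorem norm_boxVec (S : Finset (Fin n)) (w : Fin n → ℕ) (k : ℕ) : ‖boxVec S w k‖ = 1 := by
  rw [norm_eq_sqrt_re_inner (𝕜 := ℂ), inner_boxVec_self]
  simp

theorem inner_boxVec_eq_zero {S : Finset (Fin n)} {w w' : Fin n → ℕ} {i : Fin n} (hi : i ∉ S)
    (h : w i ≠ w' i) (k : ℕ) : inner ℂ (boxVec S w k) (boxVec S w' k) = (0 : ℂ) := by
  have : box S k w ∩ box S k w' = ∅ := by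
    ext z
    simp only [Finset.mem_inter, Finset.notMem_empty, iff_false, not_and]
    exact fun hz hz' => h ((eq_of_mem_box hz hi).symm.trans (eq_of_mem_box hz' hi))
  rw [inner_boxVec, this]
  simp

theorem tendsto_boxVec_bump_sub {S : Finset (Fin n)} {i : Fin n} (hi : i ∈ S) (w : Fin n → ℕ) :
    Filter.Tendsto (fun k => boxVec S (bump i w) k - boxVec S w k) Filter.atTop (nhds 0) := by
  have hsq : ∀ k, ‖boxVec S (bump i w) k - boxVec S w k‖ ^ 2 = 2 * (1 / ((k : ℝ) + 1)) := by
    intro k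
    rw [norm_sub_sq (𝕜 := ℂ), norm_boxVec, norm_boxVec, inner_boxVec]
    have h := card_box_inter_bump hi k w
    have hv : (vol S k : ℂ) ≠ 0 := by exact_mod_cast (vol_pos S k).ne'
    have hk : (k : ℂ) + 1 ≠ 0 := by exact_mod_cast k.succ_ne_zero
    have h' : ((box S k (bump i w) ∩ box S k w).card : ℂ) / vol S k = ((k / (k + 1) : ℝ) : ℂ) := by
      push_cast
      rw [div_eq_div_iff hv hk]
      exact_mod_cast h
    rw [h']
    have hk' : (k : ℝ) + 1 ≠ 0 := by positivity
    simp only [RCLike.re_to_complex, Complex.ofReal_re]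
    field_simp
    ring
  rw [tendsto_zero_iff_norm_tendsto_zero]
  have h0 := (tendsto_one_div_add_atTop_nhds_zero_nat (𝕜 := ℝ)).const_mul 2
  simp only [← hsq] at h0
  have h1 := h0.sqrt
  simpa [Real.sqrt_sq] using h1

theorem tendsto_inner_delta_boxVec {S : Finset (Fin n)} (hS : S.Nonempty) (z w : Fin n → ℕ) :
    Filter.Tendsto (fun k => inner ℂ (delta z) (boxVec S w k)) Filter.atTop (nhds (0 : ℂ)) := by
  have h0 := (tendsto_one_div_add_atTop_nhds_zero_nat (𝕜 := ℝ)).sqrt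
  rw [Real.sqrt_zero] at h0
  refine squeeze_zero_norm (fun k => ?_) h0
  rw [boxVec, inner_smul_right, inner_delta_indVec, norm_mul, norm_inv, Complex.norm_real,
    Real.norm_of_nonneg (Real.sqrt_nonneg _), ← Real.sqrt_inv, one_div]
  have h1 : √((vol S k : ℝ)⁻¹) ≤ √((k + 1 : ℝ)⁻¹) :=
    Real.sqrt_le_sqrt (inv_anti₀ (by positivity) (by exact_mod_cast succ_le_vol hS k))
  split_ifs
  · simpa using h1
  · simp

variable {S : Finset (Fin n)} {i : Fin n} {T : Hn n →L[ℂ] Hn n}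

theorem IsShift.apply_boxVec (hT : IsShift i T) (w : Fin n → ℕ) (k : ℕ) :
    T (boxVec S w k) = boxVec S (bump i w) k := by
  simp only [boxVec, map_smul, indVec, map_sum, hT.apply_delta]
  congr 1
  refine Finset.sum_nbij (bump i) (fun z hz => ?_) (bump_injective i).injOn (fun z hz => ?_)
    fun z _ => rfl
  · rw [mem_box] at hz ⊢
    intro j
    have := hz j
    by_cases hj : j = i
    · subst hj
      simp [bump]
      omega
    · simpa [bump, hj] using this
  · have hz' := mem_box.1 (Finset.mem_coe.1 hz)
    obtain ⟨y, rfl⟩ : ∃ y, z = bump i y := by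
      refine exists_eq_bump ?_
      have := hz' i
      simp [bump] at this
      omega
    refine ⟨y, Finset.mem_coe.2 (mem_box.2 fun j => ?_), rfl⟩
    have := hz' j
    by_cases hj : j = i
    · subst hj
      simp [bump] at this
      omega
    · simpa [bump, hj] using this

theorem IsShift.star_apply_boxVec_bump (hT : IsShift i T) (w : Fin n → ℕ) (k : ℕ) :
    star T (boxVec S (bump i w) k) = boxVec S w k := by
  rw [← hT.apply_boxVec, ← mul_apply_eq_comp, hT.star_mul_self,
    one_apply_eq_self]

theorem IsShift.star_apply_boxVec_of_eq_zero (hT : IsShift i T) (hi : i ∉ S) {w : Fin n → ℕ}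
    (hw : w i = 0) (k : ℕ) : star T (boxVec S w k) = 0 := by
  simp only [boxVec, map_smul, indVec, map_sum]
  rw [Finset.sum_eq_zero, smul_zero]
  exact fun z hz => hT.star_apply_of_eq_zero ((eq_of_mem_box hz hi).trans hw)

theorem IsQProj.apply_boxVec {S' : Finset (Fin n)} {Q : Hn n →L[ℂ] Hn n} (hQ : IsQProj S' Q)
    (h : S ⊆ S') {w : Fin n → ℕ} (hw : InFace S' w) (k : ℕ) : Q (boxVec S w k) = boxVec S w k := by
  simp only [boxVec, map_smul, indVec, map_sum]
  congr 1
  refine Finset.sum_congr rfl fun z hz => hQ.apply_of_inFace fun j hj => ?_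
  rw [eq_of_mem_box hz fun hj' => hj (h hj'), hw j hj]

theorem IsQProj.apply_boxVec_eq_zero {S' : Finset (Fin n)} {Q : Hn n →L[ℂ] Hn n}
    (hQ : IsQProj S' Q) (h : S ⊆ S') {w : Fin n → ℕ} (hw : ¬ InFace S' w) (k : ℕ) :
    Q (boxVec S w k) = 0 := by
  simp only [boxVec, map_smul, indVec, map_sum]
  rw [Finset.sum_eq_zero, smul_zero]
  refine fun z hz => hQ.apply_of_not_inFace fun hz' => hw fun j hj => ?_
  rw [← eq_of_mem_box hz fun hj' => hj (h hj'), hz' j hj]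

end Folner

/-! ### The representations attached to the faces -/

section Limit

open Filter Topology

variable {n : ℕ} {S : Finset (Fin n)}

/-- A free ultrafilter on `ℕ`. -/
abbrev freeUltra : Filter ℕ := (Filter.hyperfilter ℕ : Filter ℕ)

theorem freeUltra_le_atTop : freeUltra ≤ atTop := Nat.hyperfilter_le_atTop

/-- The sequences tending to zero along the free ultrafilter. -/
def nullSeq (n : ℕ) : Submodule ℂ (ℕ → Hn n) where
  carrier := {x | Tendsto x freeUltra (𝓝 0)}
  zero_mem' := tendsto_const_nhds
  add_mem' {x y} hx hy := by
    have := Tendsto.add hx hy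
    rwa [add_zero] at this
  smul_mem' c x hx := by
    have := Tendsto.const_smul hx c
    rwa [smul_zero] at this

theorem mem_nullSeq {x : ℕ → Hn n} : x ∈ nullSeq n ↔ Tendsto x freeUltra (𝓝 0) := Iff.rfl

/-- The finite linear combinations of the sequences `boxVec S w`. -/
def boxSpan (S : Finset (Fin n)) : Submodule ℂ (ℕ → Hn n) :=
  Submodule.span ℂ (Set.range (boxVec S))

/-- The sequences that are uniform limits, along the free ultrafilter, of finite linear
combinations of the sequences `boxVec S w`. -/
def limitSpace (S : Finset (Fin n)) : Submodule ℂ (ℕ → Hn n) where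
  carrier := {x | ∀ ε > 0, ∃ y ∈ boxSpan S, ∀ᶠ k in freeUltra, ‖x k - y k‖ ≤ ε}
  zero_mem' ε hε := ⟨0, zero_mem _, by simp [hε.le]⟩
  add_mem' {x x'} hx hx' ε hε := by
    obtain ⟨y, hy, h⟩ := hx (ε / 2) (half_pos hε)
    obtain ⟨y', hy', h'⟩ := hx' (ε / 2) (half_pos hε)
    refine ⟨y + y', add_mem hy hy', ?_⟩
    filter_upwards [h, h'] with k hk hk'
    calc ‖(x + x') k - (y + y') k‖ = ‖(x k - y k) + (x' k - y' k)‖ := by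
          simp only [Pi.add_apply]
          congr 1
          abel
      _ ≤ ε := (norm_add_le _ _).trans (by linarith)
  smul_mem' c x hx ε hε := by
    have hc : 0 < ‖c‖ + 1 := by positivity
    obtain ⟨y, hy, h⟩ := hx (ε / (‖c‖ + 1)) (by positivity)
    refine ⟨c • y, Submodule.smul_mem _ _ hy, ?_⟩
    filter_upwards [h] with k hk
    rw [Pi.smul_apply, Pi.smul_apply, ← smul_sub, norm_smul]
    calc ‖c‖ * ‖x k - y k‖ ≤ (‖c‖ + 1) * (ε / (‖c‖ + 1)) := by gcongr; linarith
      _ = ε := by field_simp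

theorem boxSpan_le_limitSpace (S : Finset (Fin n)) : boxSpan S ≤ limitSpace S :=
  fun x hx ε hε => ⟨x, hx, by simp [hε.le]⟩

theorem boxVec_mem_boxSpan (S : Finset (Fin n)) (w : Fin n → ℕ) : boxVec S w ∈ boxSpan S :=
  Submodule.subset_span ⟨w, rfl⟩

theorem boxVec_mem_limitSpace (S : Finset (Fin n)) (w : Fin n → ℕ) : boxVec S w ∈ limitSpace S :=
  boxSpan_le_limitSpace S (boxVec_mem_boxSpan S w)

theorem mem_limitSpace_of_approx {x : ℕ → Hn n}
    (h : ∀ ε > 0, ∃ y ∈ limitSpace S, ∀ᶠ k in freeUltra, ‖x k - y k‖ ≤ ε) :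
    x ∈ limitSpace S := by
  intro ε hε
  obtain ⟨y, hy, hxy⟩ := h (ε / 2) (half_pos hε)
  obtain ⟨z, hz, hyz⟩ := hy (ε / 2) (half_pos hε)
  refine ⟨z, hz, ?_⟩
  filter_upwards [hxy, hyz] with k h1 h2
  linarith [norm_sub_le_norm_sub_add_norm_sub (x k) (y k) (z k)]

theorem nullSeq_le_limitSpace (S : Finset (Fin n)) : nullSeq n ≤ limitSpace S := by
  intro x hx ε hε
  refine ⟨0, zero_mem _, ?_⟩
  filter_upwards [NormedAddGroup.tendsto_nhds_zero.1 hx ε hε] with k hk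
  simpa using hk.le

theorem eventually_norm_le_of_mem_limitSpace {x : ℕ → Hn n} (hx : x ∈ limitSpace S) :
    ∃ C, ∀ᶠ k in freeUltra, ‖x k‖ ≤ C := by
  have hspan : ∀ y ∈ boxSpan S, ∃ C, ∀ k, ‖y k‖ ≤ C := by
    intro y hy
    induction hy using Submodule.span_induction with
    | mem y hy =>
      obtain ⟨w, rfl⟩ := hy
      exact ⟨1, fun k => (norm_boxVec S w k).le⟩
    | zero => exact ⟨0, fun k => by simp⟩
    | add y z _ _ hy hz =>
      obtain ⟨C, hC⟩ := hy
      obtain ⟨D, hD⟩ := hz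
      exact ⟨C + D, fun k => norm_add_le_of_le (hC k) (hD k)⟩
    | smul c y _ hy =>
      obtain ⟨C, hC⟩ := hy
      refine ⟨‖c‖ * C, fun k => ?_⟩
      rw [Pi.smul_apply, norm_smul]
      exact mul_le_mul_of_nonneg_left (hC k) (norm_nonneg c)
  obtain ⟨y, hy, hxy⟩ := hx 1 one_pos
  obtain ⟨C, hC⟩ := hspan y hy
  refine ⟨1 + C, ?_⟩
  filter_upwards [hxy] with k hk
  linarith [norm_le_norm_sub_add (x k) (y k), hC k]

theorem tendsto_zero_of_mem_limitSpace {M : ℕ → (Hn n →L[ℂ] Hn n)} {C : ℝ} (hC : ∀ k, ‖M k‖ ≤ C)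
    (h : ∀ w, Tendsto (fun k => M k (boxVec S w k)) freeUltra (𝓝 0)) {x : ℕ → Hn n}
    (hx : x ∈ limitSpace S) : Tendsto (fun k => M k (x k)) freeUltra (𝓝 0) := by
  have hspan : ∀ y ∈ boxSpan S, Tendsto (fun k => M k (y k)) freeUltra (𝓝 0) := by
    intro y hy
    induction hy using Submodule.span_induction with
    | mem y hy =>
      obtain ⟨w, rfl⟩ := hy
      exact h w
    | zero => simp
    | add y z _ _ hy hz => simpa using hy.add hz
    | smul c y _ hy => simpa using hy.const_smul c
  rw [NormedAddGroup.tendsto_nhds_zero]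
  intro ε hε
  have hC0 : 0 ≤ C := (norm_nonneg _).trans (hC 0)
  obtain ⟨y, hy, hxy⟩ := hx (ε / (2 * (C + 1))) (by positivity)
  filter_upwards [hxy, NormedAddGroup.tendsto_nhds_zero.1 (hspan y hy) (ε / 2) (half_pos hε)]
    with k h1 h2
  have h3 : ‖M k (x k - y k)‖ ≤ (C + 1) * (ε / (2 * (C + 1))) :=
    (M k).le_of_opNorm_le_of_le ((hC k).trans (by linarith)) h1
  have h4 : (C + 1) * (ε / (2 * (C + 1))) = ε / 2 := by field_simp
  have h5 : M k (x k) = M k (x k - y k) + M k (y k) := by rw [← map_add, sub_add_cancel]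
  rw [h5]
  linarith [norm_add_le (M k (x k - y k)) (M k (y k))]

/-- `T` maps `limitSpace S` to itself. -/
def Preserves (S : Finset (Fin n)) (T : Hn n →L[ℂ] Hn n) : Prop :=
  ∀ x ∈ limitSpace S, (fun k => T (x k)) ∈ limitSpace S

theorem preserves_of_boxVec {T : Hn n →L[ℂ] Hn n}
    (h : ∀ w, (fun k => T (boxVec S w k)) ∈ limitSpace S) : Preserves S T := by
  intro x hx
  have hspan : ∀ y ∈ boxSpan S, (fun k => T (y k)) ∈ limitSpace S := by
    intro y hy
    induction hy using Submodule.span_induction with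
    | mem y hy =>
      obtain ⟨w, rfl⟩ := hy
      exact h w
    | zero =>
      convert zero_mem (limitSpace S) using 1
      ext1 k
      simp
    | add y z _ _ hy hz =>
      convert add_mem hy hz using 1
      ext1 k
      simp
    | smul c y _ hy =>
      convert Submodule.smul_mem _ c hy using 1
      ext1 k
      simp
  refine mem_limitSpace_of_approx fun ε hε => ?_
  obtain ⟨y, hy, hxy⟩ := hx (ε / (‖T‖ + 1)) (by positivity)
  refine ⟨_, hspan y hy, ?_⟩
  filter_upwards [hxy] with k hk
  rw [← map_sub]
  have h3 : ‖T (x k - y k)‖ ≤ (‖T‖ + 1) * (ε / (‖T‖ + 1)) :=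
    T.le_of_opNorm_le_of_le (by linarith) hk
  have h4 : (‖T‖ + 1) * (ε / (‖T‖ + 1)) = ε := by field_simp
  linarith

theorem IsShift.preserves {i : Fin n} {T : Hn n →L[ℂ] Hn n} (hT : IsShift i T) :
    Preserves S T :=
  preserves_of_boxVec fun w => by
    simp only [hT.apply_boxVec]
    exact boxVec_mem_limitSpace S _

theorem IsShift.tendsto_boxVec {i : Fin n} {T : Hn n →L[ℂ] Hn n} (hT : IsShift i T) (hi : i ∈ S)
    (w : Fin n → ℕ) :
    Tendsto (fun k => T (boxVec S w k) - boxVec S w k) freeUltra (𝓝 0) := by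
  simp only [hT.apply_boxVec]
  exact (tendsto_boxVec_bump_sub hi w).mono_left freeUltra_le_atTop

theorem IsShift.preserves_star {i : Fin n} {T : Hn n →L[ℂ] Hn n} (hT : IsShift i T) :
    Preserves S (star T) :=
  preserves_of_boxVec fun w => by
    by_cases hw : w i = 0
    · by_cases hi : i ∈ S
      · have h := ((star T).continuous.tendsto 0).comp (hT.tendsto_boxVec hi w)
        have h' : (fun k => boxVec S w k - star T (boxVec S w k)) ∈ nullSeq n := by
          rw [mem_nullSeq]
          simpa [Function.comp_def, ← mul_apply_eq_comp, hT.star_mul_self] using h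
        have := sub_mem (boxVec_mem_limitSpace S w) (nullSeq_le_limitSpace S h')
        convert this using 1
        ext1 k
        simp
      · simp only [hT.star_apply_boxVec_of_eq_zero hi hw]
        exact zero_mem _
    · obtain ⟨w, rfl⟩ := exists_eq_bump hw
      simp only [hT.star_apply_boxVec_bump]
      exact boxVec_mem_limitSpace S _

theorem preserves_of_mem_toeplitz {T : Hn n →L[ℂ] Hn n} (hT : T ∈ Toeplitz n) :
    Preserves S T := by
  have hadj : ∀ T ∈ StarAlgebra.adjoin ℂ {T : Hn n →L[ℂ] Hn n | ∃ i : Fin n, IsShift i T},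
      Preserves S T ∧ Preserves S (star T) := by
    intro T hT
    induction hT using StarAlgebra.adjoin_induction with
    | mem T hT =>
      obtain ⟨i, hT⟩ := hT
      exact ⟨hT.preserves, hT.preserves_star⟩
    | algebraMap c =>
      rw [← algebraMap_star_comm]
      exact ⟨fun x hx => Submodule.smul_mem _ c hx, fun x hx => Submodule.smul_mem _ (star c) hx⟩
    | add A B _ _ hA hB =>
      rw [star_add]
      exact ⟨fun x hx => add_mem (hA.1 x hx) (hB.1 x hx),
        fun x hx => add_mem (hA.2 x hx) (hB.2 x hx)⟩
    | mul A B _ _ hA hB =>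
      rw [star_mul]
      exact ⟨fun x hx => hA.1 _ (hB.1 x hx), fun x hx => hB.2 _ (hA.2 x hx)⟩
    | star A _ hA =>
      rw [star_star]
      exact hA.symm
  refine preserves_of_boxVec fun w => mem_limitSpace_of_approx fun ε hε => ?_
  obtain ⟨A, hA, hTA⟩ := Metric.mem_closure_iff.1 hT ε hε
  refine ⟨_, (hadj A hA).1 _ (boxVec_mem_limitSpace S w), Eventually.of_forall fun k => ?_⟩
  rw [dist_eq_norm] at hTA
  have := (T - A).le_of_opNorm_le_of_le hTA.le (norm_boxVec S w k).le
  simpa using this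

end Limit

section Representation

open Filter Topology

variable {n : ℕ} {S : Finset (Fin n)}

/-- The limit space attached to the face `S`. -/
abbrev LimitQuot (S : Finset (Fin n)) : Type :=
  limitSpace S ⧸ (nullSeq n).comap (limitSpace S).subtype

/-- The class of a sequence in the limit space. -/
def limitMk (S : Finset (Fin n)) : limitSpace S →ₗ[ℂ] LimitQuot S :=
  ((nullSeq n).comap (limitSpace S).subtype).mkQ

theorem limitMk_eq_iff {x y : limitSpace S} :
    limitMk S x = limitMk S y ↔ Tendsto (fun k => x.1 k - y.1 k) freeUltra (𝓝 0) :=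
  Submodule.Quotient.eq _

theorem limitMk_eq_zero_iff {x : limitSpace S} :
    limitMk S x = 0 ↔ Tendsto (fun k => x.1 k) freeUltra (𝓝 0) :=
  Submodule.Quotient.mk_eq_zero _

theorem limitMk_surjective (S : Finset (Fin n)) : Function.Surjective (limitMk S) :=
  Submodule.mkQ_surjective _

/-- Termwise application of an operator of the Toeplitz algebra to a sequence. -/
def limitAct (S : Finset (Fin n)) (T : Toeplitz n) : limitSpace S →ₗ[ℂ] limitSpace S :=
  LinearMap.restrict ((T.1 : Hn n →ₗ[ℂ] Hn n).compLeft ℕ) (preserves_of_mem_toeplitz T.2)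

theorem limitAct_apply (T : Toeplitz n) (x : limitSpace S) (k : ℕ) :
    (limitAct S T x).1 k = T.1 (x.1 k) := rfl

theorem limitAct_nullSeq (T : Toeplitz n) :
    (nullSeq n).comap (limitSpace S).subtype ≤
      ((nullSeq n).comap (limitSpace S).subtype).comap (limitAct S T) := by
  intro x hx
  have h := (T.1.continuous.tendsto 0).comp (mem_nullSeq.1 hx)
  rwa [map_zero] at h

/-- The representation of the Toeplitz algebra on the limit space attached to the face `S`. -/
def limitRep (S : Finset (Fin n)) : Toeplitz n →+* Module.End ℂ (LimitQuot S) where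
  toFun T := Submodule.mapQ _ _ (limitAct S T) (limitAct_nullSeq T)
  map_one' := Submodule.linearMap_qext _ rfl
  map_mul' _ _ := Submodule.linearMap_qext _ rfl
  map_zero' := Submodule.linearMap_qext _ rfl
  map_add' _ _ := Submodule.linearMap_qext _ rfl

theorem limitRep_mk (T : Toeplitz n) (x : limitSpace S) :
    limitRep S T (limitMk S x) = limitMk S (limitAct S T x) := rfl

theorem limitRep_eq_of_boxVec {A B : Toeplitz n}
    (h : ∀ w, Tendsto (fun k => A.1 (boxVec S w k) - B.1 (boxVec S w k)) freeUltra (𝓝 0)) :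
    limitRep S A = limitRep S B := by
  refine LinearMap.ext fun x => ?_
  obtain ⟨x, rfl⟩ := limitMk_surjective S x
  rw [limitRep_mk, limitRep_mk, limitMk_eq_iff]
  exact tendsto_zero_of_mem_limitSpace (M := fun _ => A.1 - B.1) (fun _ => le_rfl) h x.2

theorem tendsto_inner_boxVec (hS : S.Nonempty) (w : Fin n → ℕ) (y : Hn n) :
    Tendsto (fun k => inner ℂ y (boxVec S w k)) freeUltra (𝓝 (0 : ℂ)) := by
  have hspan : ∀ y ∈ Submodule.span ℂ (Set.range (delta : (Fin n → ℕ) → Hn n)),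
      Tendsto (fun k => inner ℂ y (boxVec S w k)) freeUltra (𝓝 (0 : ℂ)) := by
    intro y hy
    induction hy using Submodule.span_induction with
    | mem y hy =>
      obtain ⟨z, rfl⟩ := hy
      exact (tendsto_inner_delta_boxVec hS z w).mono_left freeUltra_le_atTop
    | zero => simp
    | add y z _ _ hy hz => simpa [inner_add_left] using hy.add hz
    | smul c y _ hy => simpa [inner_smul_left] using hy.mul_const (starRingEnd ℂ c)
  rw [NormedAddGroup.tendsto_nhds_zero]
  intro ε hε
  obtain ⟨z, hz, hyz⟩ := Metric.mem_closure_iff.1 (dense_span_delta n y) (ε / 2) (half_pos hε)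
  filter_upwards [NormedAddGroup.tendsto_nhds_zero.1 (hspan z hz) (ε / 2) (half_pos hε)]
    with k hk
  rw [dist_eq_norm] at hyz
  have h1 : ‖inner ℂ (y - z) (boxVec S w k)‖ ≤ ‖y - z‖ := by
    have := norm_inner_le_norm (𝕜 := ℂ) (y - z) (boxVec S w k)
    rwa [norm_boxVec, mul_one] at this
  have h2 : inner ℂ y (boxVec S w k) =
      inner ℂ (y - z) (boxVec S w k) + inner ℂ z (boxVec S w k) := by
    rw [← inner_add_left, sub_add_cancel]
  rw [h2]
  linarith [norm_add_le (inner ℂ (y - z) (boxVec S w k)) (inner ℂ z (boxVec S w k))]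

theorem IsCompactOperator.tendsto_boxVec {T : Hn n →L[ℂ] Hn n} (hT : IsCompactOperator T)
    (hS : S.Nonempty) (w : Fin n → ℕ) :
    Tendsto (fun k => T (boxVec S w k)) freeUltra (𝓝 0) := by
  obtain ⟨K, hK, hsub⟩ := hT.image_closedBall_subset_compact (f := (T : Hn n →ₗ[ℂ] Hn n)) 1
  have hmem : ∀ k, T (boxVec S w k) ∈ K := fun k =>
    hsub ⟨boxVec S w k, by simp [norm_boxVec], rfl⟩
  obtain ⟨u, -, hu⟩ := hK.ultrafilter_le_nhds
    ((Filter.hyperfilter ℕ).map fun k => T (boxVec S w k))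
    (le_principal_iff.2 (Eventually.of_forall (f := freeUltra) hmem))
  have hu' : Tendsto (fun k => T (boxVec S w k)) freeUltra (𝓝 u) := hu
  suffices u = 0 by rwa [this] at hu'
  ext z
  rw [← inner_delta]
  have h1 : Tendsto (fun k => inner ℂ (delta z) (T (boxVec S w k))) freeUltra
      (𝓝 (inner ℂ (delta z) u)) := tendsto_const_nhds.inner hu'
  simp only [← ContinuousLinearMap.adjoint_inner_left] at h1
  exact tendsto_nhds_unique h1 (tendsto_inner_boxVec hS w _)

/-- The representation of the quotient algebra on the limit space attached to the face `S`. -/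
def sphereRep (S : Finset (Fin n)) (hS : S.Nonempty) :
    QuantumSphere n →+* Module.End ℂ (LimitQuot S) :=
  (compactIdeal n).ringCon.lift (limitRep S) fun A B hAB => by
    rw [TwoSidedIdeal.rel_iff, compactIdeal, TwoSidedIdeal.mem_mk'] at hAB
    exact limitRep_eq_of_boxVec fun w => hAB.tendsto_boxVec hS w

theorem sphereRep_toSphere (hS : S.Nonempty) (T : Toeplitz n) :
    sphereRep S hS (toSphere n T) = limitRep S T := rfl

end Representation

section Rank

open Filter Topology

variable {n : ℕ} {S S' : Finset (Fin n)}

theorem limitRep_qProj_eq_zero {Q : Toeplitz n} (hQ : IsQProj S' Q.1) (h : ¬ S ⊆ S') :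
    limitRep S Q = 0 := by
  obtain ⟨i, hi, hi'⟩ := Finset.not_subset.1 h
  obtain ⟨T, hT⟩ := exists_isShift i
  let t : Toeplitz n := ⟨T, hT.mem_toeplitz⟩
  have h1 : limitRep S t = 1 := by
    rw [← map_one (limitRep S)]
    exact limitRep_eq_of_boxVec fun w => hT.tendsto_boxVec hi w
  have h2 : Q * t = 0 := Subtype.ext (hQ.mul_shift_eq_zero hT hi')
  rw [← mul_one (limitRep S Q), ← h1, ← map_mul, h2, map_zero]

theorem tendsto_boxVec_sub_boxVec_zero {w : Fin n → ℕ} (hw : InFace S w) :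
    Tendsto (fun k => boxVec S w k - boxVec S 0 k) freeUltra (𝓝 0) := by
  induction hs : ∑ i, w i generalizing w with
  | zero =>
    have : w = 0 := by
      ext i
      simpa using (Finset.sum_eq_zero_iff.1 hs) i (Finset.mem_univ i)
    simp [this]
  | succ m ih =>
    obtain ⟨i, hi⟩ : ∃ i, w i ≠ 0 := by
      by_contra! h
      simp [h] at hs
    have hiS : i ∈ S := by
      by_contra h
      exact hi (hw i h)
    obtain ⟨y, rfl⟩ := exists_eq_bump hi
    have hy := ih ((inFace_bump_iff hiS y).1 hw) (by
      rw [bump, Finset.sum_update_of_mem (Finset.mem_univ i)] at hs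
      rw [Finset.sum_eq_add_sum_sdiff_singleton_of_mem (Finset.mem_univ i)]
      omega)
    have := ((tendsto_boxVec_bump_sub hiS y).mono_left freeUltra_le_atTop).add hy
    simpa using this

theorem tendsto_sub_inner_smul_boxVec {Q : Hn n →L[ℂ] Hn n} (hQ : IsQProj S Q) {x : ℕ → Hn n}
    (hx : x ∈ limitSpace S) :
    Tendsto (fun k => Q (x k) - inner ℂ (boxVec S 0 k) (Q (x k)) • boxVec S 0 k) freeUltra
      (𝓝 0) := by
  let P (k : ℕ) : Hn n →L[ℂ] Hn n := 1 - (innerSL ℂ (boxVec S 0 k)).smulRight (boxVec S 0 k)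
  have hP (k : ℕ) (y : Hn n) : P k y = y - inner ℂ (boxVec S 0 k) y • boxVec S 0 k := rfl
  have hPle (k : ℕ) (y : Hn n) : ‖P k y‖ ≤ 2 * ‖y‖ := by
    rw [hP]
    refine (norm_sub_le _ _).trans ?_
    have := norm_inner_le_norm (𝕜 := ℂ) (boxVec S 0 k) y
    rw [norm_boxVec, one_mul] at this
    rw [norm_smul, norm_boxVec, mul_one]
    linarith
  have hPQ (k : ℕ) : ‖P k ∘L Q‖ ≤ 2 * ‖Q‖ := by
    refine ContinuousLinearMap.opNorm_le_bound _ (by positivity) fun y => ?_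
    have := Q.le_opNorm y
    have := hPle k (Q y)
    rw [ContinuousLinearMap.comp_apply]
    linarith
  refine tendsto_zero_of_mem_limitSpace hPQ (fun w => ?_) hx
  simp only [ContinuousLinearMap.comp_apply]
  by_cases hw : InFace S w
  · have h0 (k : ℕ) : P k (boxVec S 0 k) = 0 := by
      rw [hP, inner_boxVec_self, one_smul, sub_self]
    have h1 (k : ℕ) : ‖P k (Q (boxVec S w k))‖ ≤ 2 * ‖boxVec S w k - boxVec S 0 k‖ := by
      rw [hQ.apply_boxVec subset_rfl hw]
      have := hPle k (boxVec S w k - boxVec S 0 k)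
      rwa [map_sub, h0, sub_zero] at this
    have h2 := (tendsto_zero_iff_norm_tendsto_zero.1
      (tendsto_boxVec_sub_boxVec_zero hw)).const_mul 2
    rw [mul_zero] at h2
    exact squeeze_zero_norm h1 h2
  · simp [hQ.apply_boxVec_eq_zero subset_rfl hw]

/-- The class of `boxVec S w` in the limit space. -/
def limitVec (S : Finset (Fin n)) (w : Fin n → ℕ) : LimitQuot S :=
  limitMk S ⟨boxVec S w, boxVec_mem_limitSpace S w⟩

theorem limitRep_limitVec {Q : Toeplitz n} (hQ : IsQProj S' Q.1) (h : S ⊆ S') {w : Fin n → ℕ}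
    (hw : InFace S' w) : limitRep S Q (limitVec S w) = limitVec S w := by
  rw [limitVec, limitRep_mk, limitMk_eq_iff]
  simp [limitAct_apply, hQ.apply_boxVec h hw]

theorem limitVec_ne_zero (w : Fin n → ℕ) : limitVec S w ≠ 0 := by
  intro h
  have h := (limitMk_eq_zero_iff.1 h).norm
  simp only [norm_boxVec, norm_zero] at h
  exact one_ne_zero (tendsto_nhds_unique tendsto_const_nhds h)

theorem rank_limitRep_self {Q : Toeplitz n} (hQ : IsQProj S Q.1) :
    LinearMap.rank (limitRep S Q) = 1 := by
  rw [LinearMap.rank, rank_submodule_eq_one_iff]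
  refine ⟨limitVec S 0, ⟨_, limitRep_limitVec hQ subset_rfl fun i _ => rfl⟩,
    limitVec_ne_zero 0, ?_⟩
  rintro _ ⟨x, rfl⟩
  obtain ⟨x, rfl⟩ := limitMk_surjective S x
  obtain ⟨C, hC⟩ := eventually_norm_le_of_mem_limitSpace (preserves_of_mem_toeplitz Q.2 x.1 x.2)
  obtain ⟨c, -, hc⟩ := (isCompact_closedBall (0 : ℂ) C).ultrafilter_le_nhds
    ((Filter.hyperfilter ℕ).map fun k => inner ℂ (boxVec S 0 k) (Q.1 (x.1 k))) (by
      refine le_principal_iff.2 (hC.mono fun k hk => ?_)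
      have := norm_inner_le_norm (𝕜 := ℂ) (boxVec S 0 k) (Q.1 (x.1 k))
      rw [norm_boxVec, one_mul] at this
      simpa using this.trans hk)
  have hc' : Tendsto (fun k => inner ℂ (boxVec S 0 k) (Q.1 (x.1 k))) freeUltra (𝓝 c) := hc
  rw [Submodule.mem_span_singleton]
  refine ⟨c, ?_⟩
  rw [limitVec, limitRep_mk, ← map_smul, eq_comm, limitMk_eq_iff]
  have h1 : Tendsto (fun k => (inner ℂ (boxVec S 0 k) (Q.1 (x.1 k)) - c) • boxVec S 0 k)
      freeUltra (𝓝 0) := by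
    have := tendsto_zero_iff_norm_tendsto_zero.1 (tendsto_sub_nhds_zero_iff.2 hc')
    rw [tendsto_zero_iff_norm_tendsto_zero]
    simpa [norm_smul, norm_boxVec] using this
  have h2 := (tendsto_sub_inner_smul_boxVec hQ x.2).add h1
  rw [add_zero] at h2
  refine h2.congr fun k => ?_
  rw [limitAct_apply, sub_smul, sub_add_sub_cancel]
  rfl

theorem linearIndependent_limitVec {j : Fin n} (hj : j ∉ S) :
    LinearIndependent ℂ fun t : ℕ => limitVec S (Pi.single j t) := by
  rw [linearIndependent_iff']
  intro F c hc t ht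
  simp only [limitVec, ← map_smul, ← map_sum] at hc
  have h := (limitMk_eq_zero_iff.1 hc)
  have h1 (k : ℕ) : inner ℂ (boxVec S (Pi.single j t) k)
      (∑ s ∈ F, c s • boxVec S (Pi.single j s) k) = c t := by
    rw [inner_sum, Finset.sum_eq_single_of_mem t ht, inner_smul_right, inner_boxVec_self, mul_one]
    intro s _ hs
    rw [inner_smul_right, inner_boxVec_eq_zero hj (by simpa using hs.symm), mul_zero]
  have h2 : Tendsto (fun k => ∑ s ∈ F, c s • boxVec S (Pi.single j s) k) freeUltra (𝓝 0) := by
    simpa using h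
  have h3 : Tendsto (fun _ : ℕ => ‖c t‖) freeUltra (𝓝 0) := by
    refine squeeze_zero (fun _ => norm_nonneg _) (fun k => ?_)
      (tendsto_zero_iff_norm_tendsto_zero.1 h2)
    rw [← h1 k]
    have := norm_inner_le_norm (𝕜 := ℂ) (boxVec S (Pi.single j t) k)
      (∑ s ∈ F, c s • boxVec S (Pi.single j s) k)
    rwa [norm_boxVec, one_mul] at this
  exact norm_eq_zero.1 (tendsto_nhds_unique tendsto_const_nhds h3)

theorem aleph0_le_rank_limitRep {Q : Toeplitz n} (hQ : IsQProj S' Q.1) (h : S ⊂ S') :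
    Cardinal.aleph0 ≤ LinearMap.rank (limitRep S Q) := by
  obtain ⟨j, hj, hjS⟩ := Finset.exists_of_ssubset h
  have hmem (t : ℕ) : limitVec S (Pi.single j t) ∈ LinearMap.range (limitRep S Q) :=
    ⟨_, limitRep_limitVec hQ h.subset fun i hi => by
      have : i ≠ j := fun hij => hi (hij ▸ hj)
      simp [this]⟩
  have hli : LinearIndependent ℂ fun t : ℕ =>
      (⟨_, hmem t⟩ : LinearMap.range (limitRep S Q)) :=
    LinearIndependent.of_comp (LinearMap.range (limitRep S Q)).subtype
      (linearIndependent_limitVec hjS)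
  exact hli.aleph0_le_rank

end Rank

/-! ### Recovering a weighted antichain from its matrix -/

section Antichain

variable {n : ℕ}

theorem sum_antichain_index {M : Type*} [AddCommMonoid M] (A : Finset (Finset (Fin n)))
    (l : Finset (Fin n) → ℕ) (r : Finset (Fin n) → M) :
    ∑ p : (S : {x // x ∈ A}) × Fin (l S.1), r p.1.1 = ∑ S ∈ A, l S • r S := by
  rw [Fintype.sum_sigma, ← Finset.sum_coe_sort A fun S => l S • r S]
  simp

theorem IdemEquiv.symm {R : Type*} [Ring R] {ι κ : Type*} [Fintype ι] [Fintype κ]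
    {P : Matrix ι ι R} {Q : Matrix κ κ R} (h : IdemEquiv P Q) : IdemEquiv Q P := by
  obtain ⟨N, f, g, U, hU⟩ := h
  refine ⟨N, g, f, U⁻¹, ?_⟩
  rw [← hU, inv_inv]
  simp [mul_assoc]

theorem mem_and_eq_of_idemEquiv {Q : Finset (Fin n) → (Hn n →L[ℂ] Hn n)}
    (hQ : ∀ S, IsQProj S (Q S)) (hmem : ∀ S, Q S ∈ Toeplitz n)
    {A A' : Finset (Finset (Fin n))} (hA : IsAntichain (· ⊆ ·) (A : Set (Finset (Fin n))))
    (hA' : IsAntichain (· ⊆ ·) (A' : Set (Finset (Fin n)))) {l l' : Finset (Fin n) → ℕ}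
    (hl' : ∀ S ∈ A', 1 ≤ l' S)
    (h : IdemEquiv (antichainMatR A l fun S => toSphere n ⟨Q S, hmem S⟩)
      (antichainMatR A' l' fun S => toSphere n ⟨Q S, hmem S⟩))
    {S : Finset (Fin n)} (hSA : S ∈ A) (hS : S.Nonempty) (hl : 1 ≤ l S) :
    S ∈ A' ∧ l S = l' S := by
  classical
  let r (S' : Finset (Fin n)) : Cardinal := LinearMap.rank (limitRep S ⟨Q S', hmem S'⟩)
  have hr_self : r S = 1 := rank_limitRep_self (hQ S)
  have hr_zero {S' : Finset (Fin n)} (h : ¬ S ⊆ S') : r S' = 0 := by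
    simp only [r]
    rw [limitRep_qProj_eq_zero (hQ S') h, LinearMap.rank_zero]
  have hsum_mem {B : Finset (Finset (Fin n))} (hB : IsAntichain (· ⊆ ·) (B : Set (Finset (Fin n))))
      (m : Finset (Fin n) → ℕ) (hSB : S ∈ B) : ∑ S' ∈ B, m S' • r S' = m S := by
    rw [Finset.sum_eq_single_of_mem S hSB, hr_self, nsmul_one]
    intro S' hS' hne
    rw [hr_zero (hB hSB hS' hne.symm), smul_zero]
  have hsum : ∑ S' ∈ A, l S' • r S' = ∑ S' ∈ A', l' S' • r S' := by
    have hrank := IdemEquiv.sum_rank_eq (sphereRep S hS) h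
    simp only [sphereRep_toSphere] at hrank
    exact (sum_antichain_index A l r).symm.trans (hrank.trans (sum_antichain_index A' l' r))
  rw [hsum_mem hA l hSA] at hsum
  have hSA' : S ∈ A' := by
    by_contra hSA'
    by_cases hex : ∃ S' ∈ A', S ⊆ S'
    · obtain ⟨S', hS', hSS'⟩ := hex
      have hss : S ⊂ S' := Finset.ssubset_iff_subset_ne.2 ⟨hSS', fun h => hSA' (h ▸ hS')⟩
      have h1 : Cardinal.aleph0 ≤ r S' := aleph0_le_rank_limitRep (hQ S') hss
      have h2 : r S' ≤ l' S' • r S' :=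
        le_self_nsmul zero_le (Nat.one_le_iff_ne_zero.1 (hl' S' hS'))
      have h3 : l' S' • r S' ≤ ∑ S' ∈ A', l' S' • r S' :=
        Finset.single_le_sum (f := fun S' => l' S' • r S') (fun _ _ => zero_le) hS'
      rw [← hsum] at h3
      exact absurd (h1.trans (h2.trans h3)) (not_le.2 Cardinal.natCast_lt_aleph0)
    · push Not at hex
      rw [Finset.sum_eq_zero fun S' hS' => by rw [hr_zero (hex S' hS'), smul_zero]] at hsum
      have : l S = 0 := by exact_mod_cast hsum
      omega
  refine ⟨hSA', ?_⟩
  rw [hsum_mem hA' l' hSA'] at hsum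
  exact_mod_cast hsum

end Antichain

theorem stmt8 (n : ℕ) (hn : 1 ≤ n)
    (Q : Finset (Fin n) → (Hn n →L[ℂ] Hn n))
    (hQ : ∀ S, IsQProj S (Q S)) (hmem : ∀ S, Q S ∈ Toeplitz n) :
    (∀ S S' : Finset (Fin n), S'.Nonempty → S' ⊂ S → ∀ l l' : ℕ, 1 ≤ l → 1 ≤ l' →
      IdemEquiv
        (Matrix.fromBlocks
          (Matrix.diagonal fun _ : Fin l => toSphere n ⟨Q S, hmem S⟩)
          0 0
          (Matrix.diagonal fun _ : Fin l' => toSphere n ⟨Q S', hmem S'⟩))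
        (Matrix.diagonal fun _ : Fin l => toSphere n ⟨Q S, hmem S⟩)) ∧
    (∀ A A' : Finset (Finset (Fin n)),
      (∀ S ∈ A, S.Nonempty) → (∀ S ∈ A', S.Nonempty) →
      IsAntichain (· ⊆ ·) (A : Set (Finset (Fin n))) →
      IsAntichain (· ⊆ ·) (A' : Set (Finset (Fin n))) →
      ∀ l l' : Finset (Fin n) → ℕ, (∀ S ∈ A, 1 ≤ l S) → (∀ S ∈ A', 1 ≤ l' S) →
      (IdemEquiv (antichainMatR A l fun S => toSphere n ⟨Q S, hmem S⟩)
          (antichainMatR A' l' fun S => toSphere n ⟨Q S, hmem S⟩) ↔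
        A = A' ∧ ∀ S ∈ A, l S = l' S)) := by
  refine ⟨fun S S' _ h l l' hl _ => idemEquiv_absorb_qProj Q hQ hmem h l l' hl, ?_⟩
  intro A A' hA hA' hAa hAa' l l' hl hl'
  constructor
  · intro h
    have h1 := fun S hS => mem_and_eq_of_idemEquiv hQ hmem hAa hAa' hl' h hS (hA S hS) (hl S hS)
    have h2 := fun S hS => mem_and_eq_of_idemEquiv hQ hmem hAa' hAa hl h.symm hS
      (hA' S hS) (hl' S hS)
    exact ⟨Finset.Subset.antisymm (fun S hS => (h1 S hS).1) fun S hS => (h2 S hS).1,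
      fun S hS => (h1 S hS).2⟩
  · rintro ⟨rfl, hll⟩
    refine idemEquiv_antichainMatR_of_eq A hll fun S => ?_
    rw [← map_mul]
    exact congrArg (toSphere n) (Subtype.ext ((hQ S).mul_of_subset (hQ S) subset_rfl))
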